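/- arXiv:0806.0655 — 2 statements merged into one kernel-verified Lean document; each statement's English description precedes it below -/
import Mathlib

section
/- Every eigenvalue (over the complex numbers) of a totally nonnegative real n×n matrix is a nonnegative real number. -/
/-- A real square matrix is *totally nonnegative* if every minor (the determinant of
any square submatrix obtained by selecting equally many rows and columns, preserving
their order) is nonnegative. -/
def TotallyNonneg {n : ℕ} (A : Matrix (Fin n) (Fin n) ℝ) : Prop :=
  ∀ (k : ℕ) (r c : Fin k → Fin n), StrictMono r → StrictMono c →
    0 ≤ (A.submatrix r c).det

open Polynomial in
/-- Cauchy–Binet, in the averaged form. -/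
lemma tn_cauchyBinet {n k : ℕ} (A : Matrix (Fin k) (Fin n) ℝ) (B : Matrix (Fin n) (Fin k) ℝ) :
    (Nat.factorial k : ℝ) * (A * B).det =
      ∑ f : Fin k → Fin n, (A.submatrix id f).det * (B.submatrix f id).det := by
  have h1 : (A * B).det = ∑ f : Fin k → Fin n, (∏ i, A i (f i)) * (B.submatrix f id).det := by
    have := (Matrix.detRowAlternating (R := ℝ) (n := Fin k)).toMultilinearMap.map_sum
      (fun (i : Fin k) (j : Fin n) => A i j • B j)
    have e : (fun i => ∑ j, A i j • B j) = A * B := by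
      ext i j
      simp [Matrix.mul_apply, Finset.sum_apply]
    rw [e] at this
    refine Eq.trans this (Finset.sum_congr rfl fun f _ => ?_)
    have := (Matrix.detRowAlternating (R := ℝ) (n := Fin k)).toMultilinearMap.map_smul_univ
      (fun i => A i (f i)) (fun i => B (f i))
    rw [this]
    rfl
  have h2 : ∀ σ : Equiv.Perm (Fin k), (A * B).det =
      ∑ f : Fin k → Fin n, (∏ i, A i (f (σ i))) *
        ((Equiv.Perm.sign σ : ℤ) * (B.submatrix f id).det) := by
    intro σ
    rw [h1]
    refine (Fintype.sum_equiv (Equiv.arrowCongr σ.symm (Equiv.refl _)) _ _ fun f => ?_).symm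
    have : B.submatrix (f ∘ σ) id = (B.submatrix f id).submatrix σ id := by
      ext i j; rfl
    change _ = (∏ i, A i (f (σ i))) * (B.submatrix (f ∘ σ) id).det
    rw [this, Matrix.det_permute]
  have h3 : (Nat.factorial k : ℝ) * (A * B).det =
      ∑ σ : Equiv.Perm (Fin k), (A * B).det := by
    simp [Fintype.card_perm]
  rw [h3, Finset.sum_congr rfl fun σ _ => h2 σ, Finset.sum_comm]
  refine Finset.sum_congr rfl fun f _ => ?_
  rw [← Matrix.det_transpose (A.submatrix id f), Matrix.det_apply' (Matrix.transpose _), Finset.sum_mul]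
  refine Finset.sum_congr rfl fun σ _ => ?_
  simp only [Matrix.transpose_apply, Matrix.submatrix_apply, id]
  ring

lemma TotallyNonneg.mul {n : ℕ} {A B : Matrix (Fin n) (Fin n) ℝ} (hA : TotallyNonneg A)
    (hB : TotallyNonneg B) : TotallyNonneg (A * B) := by
  intro k r c hr hc
  have h := tn_cauchyBinet (A.submatrix r id) (B.submatrix id c)
  rw [← Matrix.submatrix_mul _ _ _ _ _ Function.bijective_id] at h
  have hk : (0 : ℝ) < Nat.factorial k := by exact_mod_cast Nat.factorial_pos k
  refine nonneg_of_mul_nonneg_right (a := (Nat.factorial k : ℝ)) ?_ hk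
  rw [h]
  refine Finset.sum_nonneg fun f _ => ?_
  by_cases hf : Function.Injective f
  · set σ := Tuple.sort f
    have hm : StrictMono (f ∘ σ) :=
      (Tuple.monotone_sort f).strictMono_of_injective (hf.comp σ.injective)
    have a1 := hA k r (f ∘ σ) hr hm
    have b1 := hB k (f ∘ σ) c hm hc
    have ea : (A.submatrix r (f ∘ σ)) = ((A.submatrix r f).submatrix id σ) := rfl
    have eb : (B.submatrix (f ∘ σ) c) = ((B.submatrix f c).submatrix σ id) := rfl
    rw [ea, Matrix.det_permute'] at a1
    rw [eb, Matrix.det_permute] at b1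
    have := mul_nonneg a1 b1
    have hs : ((Equiv.Perm.sign σ : ℤ) : ℝ) * ((Equiv.Perm.sign σ : ℤ) : ℝ) = 1 := by
      rcases Int.units_eq_one_or (Equiv.Perm.sign σ) with h | h <;> simp [h]
    calc (0:ℝ) ≤ _ := this
      _ = (((Equiv.Perm.sign σ : ℤ) : ℝ) * ((Equiv.Perm.sign σ : ℤ) : ℝ)) *
        ((A.submatrix r f).det * (B.submatrix f c).det) := by ring
      _ = _ := by rw [hs, one_mul]; rfl
  · have : ∃ i j, f i = f j ∧ i ≠ j := by
      simpa [Function.Injective] using hf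
    obtain ⟨i, j, hij, hne⟩ := this
    have : ((B.submatrix id c).submatrix f id).det = 0 :=
      Matrix.det_zero_of_row_eq hne (by ext x; simp [hij])
    rw [this, mul_zero]

lemma TotallyNonneg.diagonal {n : ℕ} (d : Fin n → ℝ) (hd : ∀ i, 0 ≤ d i) 
    {A : Matrix (Fin n) (Fin n) ℝ} (hA : TotallyNonneg A) :
    TotallyNonneg (A * Matrix.diagonal d) := by
  intro k r c hr hc
  have : (A * Matrix.diagonal d).submatrix r c =
      A.submatrix r c * Matrix.diagonal (d ∘ c) := by
    ext i j; simp
  rw [this, Matrix.det_mul, Matrix.det_diagonal]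
  exact mul_nonneg (hA k r c hr hc) (Finset.prod_nonneg fun i _ => hd _)

lemma TotallyNonneg.pow_succ {n : ℕ} {A : Matrix (Fin n) (Fin n) ℝ} (hA : TotallyNonneg A)
    (m : ℕ) : TotallyNonneg (A ^ (m + 1)) := by
  induction m with
  | zero => simpa using hA
  | succ m ih => rw [_root_.pow_succ]; exact ih.mul hA

/-- principal minors -/
noncomputable def tnpm {n : ℕ} (A : Matrix (Fin n) (Fin n) ℝ) (S : Finset (Fin n)) : ℝ :=
  (A.submatrix (Subtype.val : S → Fin n) (Subtype.val : S → Fin n)).det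

lemma tnpm_eq {n k : ℕ} (A : Matrix (Fin n) (Fin n) ℝ) (S : Finset (Fin n)) (h : S.card = k) :
    tnpm A S = (A.submatrix (S.orderEmbOfFin h) (S.orderEmbOfFin h)).det := by
  rw [tnpm, ← Matrix.det_submatrix_equiv_self (S.orderIsoOfFin h).toEquiv]
  rfl

lemma TotallyNonneg.pm_nonneg {n : ℕ} {A : Matrix (Fin n) (Fin n) ℝ} (hA : TotallyNonneg A)
    (S : Finset (Fin n)) : 0 ≤ tnpm A S := by
  rw [tnpm_eq A S rfl]
  exact hA _ _ _ (S.orderEmbOfFin rfl).strictMono (S.orderEmbOfFin rfl).strictMono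

lemma tnpm_mul_diagonal {n : ℕ} (A : Matrix (Fin n) (Fin n) ℝ) (d : Fin n → ℝ)
    (S : Finset (Fin n)) : tnpm (A * Matrix.diagonal d) S = tnpm A S * ∏ i ∈ S, d i := by
  have : (A * Matrix.diagonal d).submatrix (Subtype.val : S → Fin n) (Subtype.val : S → Fin n) =
      A.submatrix (Subtype.val : S → Fin n) (Subtype.val : S → Fin n) *
        Matrix.diagonal (fun i : S => d i) := by
    ext i j; simp
  rw [tnpm, this, Matrix.det_mul, Matrix.det_diagonal, tnpm, Finset.prod_coe_sort S d]

lemma tn_coeff {n : ℕ} (A : Matrix (Fin n) (Fin n) ℝ) (k : ℕ) (hk : k ≤ n) :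
    (-A).charpoly.coeff (n - k) = ∑ S ∈ Finset.univ.powersetCard k, tnpm A S := by
  have := Matrix.charpoly_coeff_eq_sum_minors (-A) k (by simpa using hk)
  rw [Fintype.card_fin] at this
  rw [this, Finset.mul_sum]
  refine Finset.sum_congr rfl fun S hS => ?_
  have hS := (Finset.mem_powersetCard.1 hS).2
  have e : (-A).submatrix (Subtype.val : S → Fin n) (Subtype.val : S → Fin n) =
    -(A.submatrix (Subtype.val : S → Fin n) (Subtype.val : S → Fin n)) := rfl
  rw [e, Matrix.det_neg, Fintype.card_coe, hS, ← mul_assoc, ← mul_pow]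
  simp [tnpm]

lemma tn_natDegree {n : ℕ} (A : Matrix (Fin n) (Fin n) ℝ) : (-A).charpoly.natDegree = n := by
  simp [Matrix.charpoly_natDegree_eq_dim]

lemma TotallyNonneg.coeff_nonneg {n : ℕ} {A : Matrix (Fin n) (Fin n) ℝ} (hA : TotallyNonneg A)
    (j : ℕ) : 0 ≤ (-A).charpoly.coeff j := by
  by_cases hj : j ≤ n
  · obtain ⟨k, rfl⟩ := Nat.exists_eq_add_of_le hj
    have := tn_coeff A k (by omega)
    rw [Nat.add_sub_cancel] at this
    rw [this]
    exact Finset.sum_nonneg fun S _ => hA.pm_nonneg S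
  · rw [Polynomial.coeff_eq_zero_of_natDegree_lt]
    rw [tn_natDegree]; omega

/-- Schur complement formula for the determinant. -/
lemma tn_schur {k : ℕ} (N : Matrix (Fin (k+1)) (Fin (k+1)) ℝ) (h : N 0 0 ≠ 0) :
    N.det = N 0 0 *
      (Matrix.of fun i j : Fin k => N i.succ j.succ - N i.succ 0 * N 0 j.succ / N 0 0).det := by
  let B : Matrix (Fin (k+1)) (Fin (k+1)) ℝ := fun i j =>
    N i j - (if i = 0 then 0 else N i 0 / N 0 0) * N 0 j
  have hB : N.det = B.det := by
    refine Matrix.det_eq_of_forall_row_eq_smul_add_const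
      (fun i => if i = 0 then 0 else N i 0 / N 0 0) 0 (by simp) fun i j => ?_
    simp [B]
  rw [hB, Matrix.det_succ_column_zero, Finset.sum_eq_single 0]
  · simp only [Fin.val_zero, pow_zero, one_mul]
    congr 1
    · simp [B]
    · congr 1
      ext i j
      change N i.succ j.succ - (if i.succ = 0 then 0 else N i.succ 0 / N 0 0) * N 0 j.succ =
        N i.succ j.succ - N i.succ 0 * N 0 j.succ / N 0 0
      rw [if_neg (Fin.succ_ne_zero i)]
      ring
  · intro i _ hi
    have : B i 0 = 0 := by simp [B, hi, h]
    simp [this]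
  · simp

lemma tn_leading {k : ℕ} (M : Matrix (Fin (k+1)) (Fin (k+1)) ℝ) (hM : TotallyNonneg M)
    (h : M.det ≠ 0) : (M.submatrix Fin.castSucc Fin.castSucc).det ≠ 0 := by
  induction k with
  | zero => simp
  | succ k ih =>
    have hent : ∀ i j, 0 ≤ M i j := by
      intro i j
      have := hM 1 (fun _ => i) (fun _ => j) (Subsingleton.strictMono _)
        (Subsingleton.strictMono _)
      simpa using this
    have h00 : M 0 0 ≠ 0 := by
      intro h0
      have hp : ∀ i j : Fin (k+1), M 0 j.succ * M i.succ 0 = 0 := by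
        intro i j
        have := hM 2 ![0, i.succ] ![0, j.succ] (by simp [Fin.strictMono_iff_lt_succ])
          (by simp [Fin.strictMono_iff_lt_succ])
        rw [Matrix.det_fin_two] at this
        simp [h0] at this
        exact le_antisymm this (mul_nonneg (hent _ _) (hent _ _))
      by_cases hr : ∀ j : Fin (k+1), M 0 j.succ = 0
      · exact h (Matrix.det_eq_zero_of_row_eq_zero 0 fun j => by
          refine Fin.cases h0 hr j)
      · push Not at hr
        obtain ⟨j, hj⟩ := hr
        refine h (Matrix.det_eq_zero_of_column_eq_zero 0 fun i => ?_)
        refine Fin.cases h0 (fun i => ?_) i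
        exact (mul_eq_zero.1 (hp i j)).resolve_left hj
    have hpos : 0 < M 0 0 := lt_of_le_of_ne (hent _ _) (Ne.symm h00)
    set C : Matrix (Fin (k+1)) (Fin (k+1)) ℝ := 
      Matrix.of fun i j => M i.succ j.succ - M i.succ 0 * M 0 j.succ / M 0 0 with hC
    have hsub : ∀ (m : ℕ) (r c : Fin m → Fin (k+1)),
        (M.submatrix (Fin.cons 0 (Fin.succ ∘ r) : Fin (m+1) → Fin (k+2)) 
          (Fin.cons 0 (Fin.succ ∘ c) : Fin (m+1) → Fin (k+2))).det = 
          M 0 0 * (C.submatrix r c).det := by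
      intro m r c
      rw [tn_schur _ (by simpa using h00)]
      rfl
    have hmono : ∀ (m : ℕ) (r : Fin m → Fin (k+1)), StrictMono r →
        StrictMono (Fin.cons 0 (Fin.succ ∘ r) : Fin (m+1) → Fin (k+2)) := by
      intro m r hr i j hij
      induction j using Fin.cases with
      | zero => simp at hij
      | succ j =>
        induction i using Fin.cases with
        | zero => simp
        | succ i => simpa using hr (by simpa using hij)
    have hCT : TotallyNonneg C := by
      intro m r c hr hc
      have := hM _ _ _ (hmono m r hr) (hmono m c hc)
      rw [hsub] at this
      exact nonneg_of_mul_nonneg_right this hpos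
    have hCd : C.det ≠ 0 := by
      rw [tn_schur M h00] at h
      exact right_ne_zero_of_mul h
    have h2 := ih C hCT hCd
    rw [tn_schur _ (by simpa using h00)]
    exact mul_ne_zero (by simpa using h00) h2

open Polynomial in
lemma tn_root_iff {n : ℕ} (A : Matrix (Fin n) (Fin n) ℝ) (w : ℂ) :
    aeval w (-A).charpoly = 0 ↔ -w ∈ spectrum ℂ (A.map (algebraMap ℝ ℂ)) := by
  have h1 : (-A).charpoly.map (algebraMap ℝ ℂ) = (-(A.map (algebraMap ℝ ℂ))).charpoly := by
    rw [← Matrix.charpoly_map]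
    congr 1
    ext i j
    simp
  rw [← eval_map_algebraMap, h1, ← IsRoot.def, ← Matrix.mem_spectrum_iff_isRoot_charpoly,
    ← spectrum.neg_eq, Set.mem_neg]

open Polynomial in
lemma tn_kellogg {n : ℕ} (P : ℝ[X]) (hm : P.Monic) (hd : P.natDegree = n)
    (hc : ∀ j, 0 ≤ P.coeff j) (ρ φ : ℝ) (hρ : 0 < ρ) (hφ : 0 ≤ φ) (hn : n * φ < Real.pi) :
    aeval ((ρ : ℂ) * Complex.exp (φ * Complex.I)) P ≠ 0 := by
  have hlead : P.coeff n = 1 := by rw [← hd]; exact hm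
  have hx : ∀ j : ℕ, ((ρ : ℂ) * Complex.exp (φ * Complex.I)) ^ j =
      ((ρ ^ j : ℝ) : ℂ) * Complex.exp (((j * φ : ℝ) : ℂ) * Complex.I) := by
    intro j
    rw [mul_pow, ← Complex.exp_nat_mul]
    push_cast
    ring_nf
  intro h0
  rw [aeval_eq_sum_range, hd, Finset.sum_congr rfl fun j _ => by rw [hx j]] at h0
  rcases hφ.eq_or_lt with rfl | hφ
  · have := congrArg Complex.re h0
    rw [Complex.re_sum] at this
    have hpos : 0 < ∑ j ∈ Finset.range (n + 1), P.coeff j * ρ ^ j := by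
      refine Finset.sum_pos' (fun j _ => mul_nonneg (hc j) (by positivity))
        ⟨n, by simp, by rw [hlead]; positivity⟩
    refine hpos.ne' (Eq.trans (Finset.sum_congr rfl fun j _ => ?_) this)
    simp [-Complex.ofReal_pow]
  · have := congrArg Complex.im h0
    rw [Complex.im_sum] at this
    rcases Nat.eq_zero_or_pos n with rfl | hn0
    · have := congrArg Complex.re h0
      simp [hlead] at this
    have hs : ∀ j ∈ Finset.range (n + 1), 0 ≤ P.coeff j * (ρ ^ j * Real.sin (j * φ)) := by
      intro j hj
      refine mul_nonneg (hc j) (mul_nonneg (by positivity)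
        (Real.sin_nonneg_of_nonneg_of_le_pi (by positivity) (le_trans ?_ hn.le)))
      have : (j : ℝ) ≤ n := by exact_mod_cast Nat.lt_succ_iff.1 (Finset.mem_range.1 hj)
      gcongr
    have hpos : 0 < ∑ j ∈ Finset.range (n + 1), P.coeff j * (ρ ^ j * Real.sin (j * φ)) := by
      refine Finset.sum_pos' hs ⟨n, by simp, ?_⟩
      rw [hlead, one_mul]
      exact mul_pos (by positivity) (Real.sin_pos_of_pos_of_lt_pi (by positivity) hn)
    refine hpos.ne' (Eq.trans (Finset.sum_congr rfl fun j _ => ?_) this)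
    rw [Complex.real_smul, Complex.im_ofReal_mul, Complex.im_ofReal_mul, Complex.exp_ofReal_mul_I_im]

open Polynomial in
lemma tn_gap_aux {n : ℕ} {A : Matrix (Fin n) (Fin n) ℝ} (hA : TotallyNonneg A) (w : ℂ)
    (hw : aeval w (-A).charpoly = 0) (him : w.im < 0) :
    -w.re ≤ Real.cos (Real.pi / (n + 1)) * ‖w‖ := by
  by_contra! hcon
  have hpi := Real.pi_pos
  set μ := -w with hμ
  set θ := Complex.arg μ with hθ
  have hμ0 : μ ≠ 0 := by
    intro h
    have : w = 0 := by simpa [hμ] using h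
    simp [this] at him
  have hnpos : 0 < ‖μ‖ := norm_pos_iff.2 hμ0
  have hμim : 0 < μ.im := by simp [hμ, him]
  have hθ0 : 0 < θ := by
    refine lt_of_le_of_ne (Complex.arg_nonneg_iff.2 hμim.le) fun h => ?_
    have := (Complex.arg_eq_zero_iff.1 h.symm).2
    linarith
  have hθpi : θ ≤ Real.pi := Complex.arg_le_pi μ
  have hlt : θ < Real.pi / (n + 1) := by
    by_contra! h
    have h1 := Real.cos_le_cos_of_nonneg_of_le_pi (by positivity) hθpi h
    rw [hθ, Complex.cos_arg hμ0, div_le_iff₀ hnpos] at h1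
    have : ‖μ‖ = ‖w‖ := by simp [hμ]
    rw [this] at h1
    simp [hμ] at h1
    linarith
  obtain ⟨m, hm⟩ : ∃ m : ℕ, ⌈Real.pi / θ⌉₊ = m + 1 := by
    refine Nat.exists_eq_succ_of_ne_zero ?_
    have : 0 < ⌈Real.pi / θ⌉₊ := Nat.ceil_pos.2 (by positivity)
    omega
  have h1 : Real.pi ≤ (m + 1 : ℕ) * θ := by
    have := Nat.le_ceil (Real.pi / θ)
    rw [hm, div_le_iff₀ hθ0] at this
    exact this
  have h2 : (m + 1 : ℕ) * θ < Real.pi + θ := by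
    have := Nat.ceil_lt_add_one (show 0 ≤ Real.pi / θ by positivity)
    rw [hm] at this
    have := mul_lt_mul_of_pos_right this hθ0
    rwa [add_mul, div_mul_cancel₀ _ hθ0.ne', one_mul] at this
  have hspec := (tn_root_iff A w).1 hw
  have hspec2 := spectrum.pow_mem_pow (𝕜 := ℂ) _ (m + 1) hspec
  have hmap : (A.map (algebraMap ℝ ℂ)) ^ (m + 1) = (A ^ (m + 1)).map (algebraMap ℝ ℂ) := by
    rw [Matrix.map_pow]
  rw [hmap, ← neg_neg ((-w) ^ (m + 1)), ← tn_root_iff] at hspec2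
  have hx : -(-w) ^ (m + 1) = ((‖μ‖ ^ (m + 1) : ℝ) : ℂ) *
      Complex.exp ((((m + 1 : ℕ) * θ - Real.pi : ℝ) : ℂ) * Complex.I) := by
    have e1 : μ = ‖μ‖ * Complex.exp (θ * Complex.I) := (Complex.norm_mul_exp_arg_mul_I μ).symm
    have e2 : Complex.exp ((((m + 1 : ℕ) * θ - Real.pi : ℝ) : ℂ) * Complex.I) =
        - Complex.exp (θ * Complex.I) ^ (m + 1) := by
      rw [← Complex.exp_nat_mul]
      push_cast
      rw [sub_mul, Complex.exp_sub, Complex.exp_pi_mul_I, div_neg, div_one]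
      ring_nf
    rw [e2, ← hμ]
    conv_lhs => rw [e1]
    push_cast
    ring
  rw [hx] at hspec2
  refine tn_kellogg (n := n) _ (Matrix.charpoly_monic _) (tn_natDegree _)
    (hA.pow_succ m).coeff_nonneg _ _ (by positivity) (by linarith) ?_ hspec2
  have h3 : (m + 1 : ℕ) * θ - Real.pi ≤ Real.pi / (n + 1) := by linarith
  calc (n : ℝ) * ((m + 1 : ℕ) * θ - Real.pi) ≤ n * (Real.pi / (n + 1)) := by gcongr
    _ < (n + 1) * (Real.pi / (n + 1)) := by
        have : 0 < Real.pi / ((n : ℝ) + 1) := by positivity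
        nlinarith
    _ = Real.pi := by field_simp

open Polynomial in
lemma tn_gap {n : ℕ} {A : Matrix (Fin n) (Fin n) ℝ} (hA : TotallyNonneg A) (w : ℂ)
    (hw : aeval w (-A).charpoly = 0) :
    (w.re ≤ 0 ∧ w.im = 0) ∨ (w.im ≠ 0 ∧ -w.re ≤ Real.cos (Real.pi / (n + 1)) * ‖w‖) := by
  rcases lt_trichotomy w.im 0 with h | h | h
  · exact Or.inr ⟨h.ne, tn_gap_aux hA w hw h⟩
  · left
    refine ⟨?_, h⟩
    by_contra! hpos
    refine tn_kellogg (n := n) _ (Matrix.charpoly_monic (-A)) (tn_natDegree _) hA.coeff_nonneg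
      w.re 0 hpos le_rfl (by simpa using Real.pi_pos) ?_
    have : w = (w.re : ℂ) * Complex.exp ((0 : ℝ) * Complex.I) := by
      apply Complex.ext <;> simp [h]
    rw [← this, hw]
  · right
    refine ⟨h.ne', ?_⟩
    have hw' : aeval ((starRingEnd ℂ) w) (-A).charpoly = 0 := by
      rw [Polynomial.aeval_conj, hw, map_zero]
    have := tn_gap_aux hA _ hw' (by simpa using h)
    simpa using this

open Polynomial in
/-- divided difference of `Q` at `w` and its conjugate -/
noncomputable def tnDD (Q : ℝ[X]) (w : ℂ) : ℂ :=
  ∑ j ∈ Finset.range (Q.natDegree + 1), (Q.coeff j : ℂ) *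
    ∑ i ∈ Finset.range j, w ^ i * ((starRingEnd ℂ) w) ^ (j - 1 - i)

open Polynomial in
lemma tnDD_mul (Q : ℝ[X]) (w : ℂ) :
    tnDD Q w * (w - (starRingEnd ℂ) w) = aeval w Q - aeval ((starRingEnd ℂ) w) Q := by
  rw [tnDD, Finset.sum_mul, aeval_eq_sum_range, aeval_eq_sum_range, ← Finset.sum_sub_distrib]
  refine Finset.sum_congr rfl fun j _ => ?_
  rw [mul_assoc, (Commute.all _ _).geom_sum₂_mul, Complex.real_smul, Complex.real_smul, mul_sub]

open Polynomial in
lemma tnDD_zero (Q : ℝ[X]) : tnDD Q 0 = Q.coeff 1 := by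
  rw [tnDD]
  have h : ∀ j ∈ Finset.range (Q.natDegree + 1), j ≠ 1 → (Q.coeff j : ℂ) *
    ∑ i ∈ Finset.range j, (0 : ℂ) ^ i * ((starRingEnd ℂ) 0) ^ (j - 1 - i) = 0 := by
    intro j _ hj
    rw [Finset.sum_eq_zero, mul_zero]
    intro i hi
    rw [Finset.mem_range] at hi
    rcases Nat.eq_zero_or_pos i with rfl | h
    · rw [map_zero, zero_pow (M₀ := ℂ) (n := j - 1 - 0) (by omega), mul_zero]
    · rw [zero_pow h.ne', zero_mul]
  rw [Finset.sum_eq_single 1 h]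
  · simp
  · intro h1
    rw [coeff_eq_zero_of_natDegree_lt]
    · simp
    · simpa using h1

lemma tnDD_continuous (Q : Polynomial ℝ) : Continuous (tnDD Q) := by
  unfold tnDD
  have := Complex.continuous_conj
  fun_prop

open Polynomial in
lemma tn_im_bound (Q : ℝ[X]) (hm : Q.Monic) (h : ∀ w : ℂ, aeval w Q = 0 → w.im = 0) (z : ℂ) :
    |z.im| ^ Q.natDegree ≤ ‖aeval z Q‖ := by
  set P := Q.map (algebraMap ℝ ℂ) with hP
  have hPm : P.Monic := hm.map _
  have hs : P.Splits := IsAlgClosed.splits P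
  have hd : P.natDegree = Q.natDegree := by rw [hP, hm.natDegree_map]
  rw [← eval_map_algebraMap, ← hP, hs.eval_eq_prod_roots_of_monic hPm, ← hd, hs.natDegree_eq_card_roots]
  have hr : ∀ w ∈ P.roots, w.im = 0 := by
    intro w hw
    apply h
    rw [← eval_map_algebraMap]
    exact (mem_roots'.1 hw).2
  revert hr
  generalize P.roots = s
  induction s using Multiset.induction with
  | empty => simp
  | cons a s ih =>
    intro hr
    have h1 := ih fun w hw => hr w (Multiset.mem_cons_of_mem hw)
    have h2 : |z.im| ≤ ‖z - a‖ := by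
      have := Complex.abs_im_le_norm (z - a)
      rwa [Complex.sub_im, hr a (Multiset.mem_cons_self a s), sub_zero] at this
    rw [Multiset.card_cons, Multiset.map_cons, Multiset.prod_cons, norm_mul, pow_succ, mul_comm]
    exact mul_le_mul h2 h1 (by positivity) (norm_nonneg _)

open Polynomial in
lemma tn_root_bound (Q : ℝ[X]) (hm : Q.Monic) (B : ℝ) (hB : ∀ j < Q.natDegree, |Q.coeff j| ≤ B)
    (hB0 : 0 ≤ B)
    (w : ℂ) (hw : aeval w Q = 0) : ‖w‖ ≤ B + 1 := by
  set P := Q.map (algebraMap ℝ ℂ) with hP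
  have hPm : P.Monic := hm.map _
  have hd : P.natDegree = Q.natDegree := by rw [hP, hm.natDegree_map]
  have h1 : P.IsRoot w := by rw [IsRoot.def, hP, eval_map_algebraMap, hw]
  have h2 := IsRoot.norm_lt_cauchyBound hPm.ne_zero h1
  have h3 : cauchyBound P ≤ B.toNNReal + 1 := by
    rw [cauchyBound, hPm.leadingCoeff, nnnorm_one, div_one]
    gcongr
    refine Finset.sup_le fun j hj => ?_
    rw [Finset.mem_range, hd] at hj
    rw [Real.le_toNNReal_iff_coe_le hB0]
    simpa [hP] using hB j hj
  have h4 : ((‖w‖₊ : NNReal) : ℝ) ≤ ((B.toNNReal + 1 : NNReal) : ℝ) := by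
    exact_mod_cast h2.le.trans h3
  simpa [hB0] using h4

open Polynomial in
lemma tn_path {r : ℕ} (Q0 Q1 : ℝ[X]) (m0 : Q0.Monic) (m1 : Q1.Monic) (d0 : Q0.natDegree = r)
    (d1 : Q1.natDegree = r) (c : ℝ) (hc : c < 1)
    (H : ∀ t ∈ Set.Icc (0:ℝ) 1, ∀ w : ℂ, aeval w (C (1 - t) * Q0 + C t * Q1) = 0 →
      (w.re ≤ 0 ∧ w.im = 0) ∨ (w.im ≠ 0 ∧ -w.re ≤ c * ‖w‖))
    (H0 : ∀ w : ℂ, aeval w Q0 = 0 → (w.re ≤ 0 ∧ w.im = 0))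
    (h01 : Q0.coeff 0 ≠ 0 ∨ Q0.coeff 1 ≠ 0)
    (ht : ∀ t ∈ Set.Ioc (0:ℝ) 1, (1 - t) * Q0.coeff 0 + t * Q1.coeff 0 ≠ 0) (w : ℂ)
    (hw : aeval w Q1 = 0) : w.re ≤ 0 ∧ w.im = 0 := by
  let Q : ℝ → ℝ[X] := fun t => C (1 - t) * Q0 + C t * Q1
  have hQc : ∀ t j, (Q t).coeff j = (1 - t) * Q0.coeff j + t * Q1.coeff j := by
    intro t j
    simp only [Q, coeff_add, coeff_C_mul]
  have l0 : Q0.coeff r = 1 := by rw [← d0]; exact m0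
  have l1 : Q1.coeff r = 1 := by rw [← d1]; exact m1
  have hQr : ∀ t, (Q t).coeff r = 1 := by intro t; rw [hQc, l0, l1]; ring
  have hQle : ∀ t, (Q t).natDegree ≤ r := by
    intro t
    refine natDegree_le_iff_coeff_eq_zero.2 fun j hj => ?_
    rw [hQc, coeff_eq_zero_of_natDegree_lt (by omega), coeff_eq_zero_of_natDegree_lt (by omega)]
    ring
  have hQm : ∀ t, (Q t).Monic := fun t => monic_of_natDegree_le_of_coeff_eq_one r (hQle t) (hQr t)
  have hQd : ∀ t, (Q t).natDegree = r := fun t =>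
    le_antisymm (hQle t) (le_natDegree_of_ne_zero (by rw [hQr]; exact one_ne_zero))
  have hQe : ∀ t (z : ℂ), aeval z (Q t) = (1 - t : ℝ) * aeval z Q0 + (t : ℝ) * aeval z Q1 := by
    intro t z; simp [Q]
  let G : ℝ → ℂ → ℂ := fun t z => (1 - t : ℝ) * tnDD Q0 z + (t : ℝ) * tnDD Q1 z
  have hGmul : ∀ t z, aeval z (Q t) = 0 → z.im ≠ 0 → G t z = 0 := by
    intro t z hz him
    have hz' : aeval ((starRingEnd ℂ) z) (Q t) = 0 := by
      rw [Polynomial.aeval_conj, hz, map_zero]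
    have hne : z - (starRingEnd ℂ) z ≠ 0 := by
      rw [sub_ne_zero]
      intro h
      exact him (Complex.conj_eq_iff_im.1 h.symm)
    have : G t z * (z - (starRingEnd ℂ) z) = 0 := by
      simp only [G]
      rw [add_mul, mul_assoc, mul_assoc, tnDD_mul, tnDD_mul]
      rw [hQe] at hz hz'
      linear_combination hz - hz'
    exact (mul_eq_zero.1 this).resolve_right hne
  let B : ℝ := ∑ j ∈ Finset.range r, (|Q0.coeff j| + |Q1.coeff j|)
  have hB0 : 0 ≤ B := Finset.sum_nonneg fun j _ => by positivity
  have hR : ∀ t ∈ Set.Icc (0:ℝ) 1, ∀ z : ℂ, aeval z (Q t) = 0 → ‖z‖ ≤ B + 1 := by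
    intro t ht z hz
    refine tn_root_bound (Q t) (hQm t) B (fun j hj => ?_) hB0 z hz
    rw [hQd] at hj
    have h1 : |Q0.coeff j| + |Q1.coeff j| ≤ B :=
      Finset.single_le_sum (f := fun j => |Q0.coeff j| + |Q1.coeff j|)
        (fun j _ => by positivity) (Finset.mem_range.2 hj)
    refine le_trans ?_ h1
    rw [hQc]
    refine (abs_add_le _ _).trans ?_
    rw [abs_mul, abs_mul, abs_of_nonneg ht.1, abs_of_nonneg (show 0 ≤ 1 - t by linarith [ht.2])]
    have a := abs_nonneg (Q0.coeff j)
    have b := abs_nonneg (Q1.coeff j)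
    nlinarith [ht.1, ht.2]
  have hFc : Continuous fun p : ℝ × ℂ => aeval p.2 (Q p.1) := by
    simp only [hQe]
    have a0 : Continuous fun p : ℝ × ℂ => aeval p.2 Q0 := Q0.continuous_aeval.comp continuous_snd
    have a1 : Continuous fun p : ℝ × ℂ => aeval p.2 Q1 := Q1.continuous_aeval.comp continuous_snd
    fun_prop
  have hGc : Continuous fun p : ℝ × ℂ => G p.1 p.2 := by
    have a0 : Continuous fun p : ℝ × ℂ => tnDD Q0 p.2 := (tnDD_continuous Q0).comp continuous_snd
    have a1 : Continuous fun p : ℝ × ℂ => tnDD Q1 p.2 := (tnDD_continuous Q1).comp continuous_snd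
    simp only [G]
    fun_prop
  let T1 : Set ℝ := {t | ∀ z : ℂ, |z.im| ^ r ≤ ‖aeval z (Q t)‖}
  let S2 : Set (ℝ × ℂ) := (Set.Icc (0:ℝ) 1 ×ˢ Metric.closedBall (0:ℂ) (B + 1)) ∩
    {p | aeval p.2 (Q p.1) = 0 ∧ G p.1 p.2 = 0 ∧ -p.2.re ≤ c * ‖p.2‖}
  let T2 : Set ℝ := Prod.fst '' S2
  have hT1 : IsClosed T1 := by
    have : T1 = ⋂ z : ℂ, {t | |z.im| ^ r ≤ ‖aeval z (Q t)‖} := by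
      ext t; simp [T1]
    rw [this]
    refine isClosed_iInter fun z => isClosed_le continuous_const ?_
    exact (hFc.comp (show Continuous fun t : ℝ => (t, z) by fun_prop)).norm
  have hT2 : IsClosed T2 := by
    refine (IsCompact.image (IsCompact.inter_right
      (isCompact_Icc.prod (isCompact_closedBall _ _)) ?_) continuous_fst).isClosed
    have c3 : IsClosed {p : ℝ × ℂ | -p.2.re ≤ c * ‖p.2‖} :=
      isClosed_le (Complex.continuous_re.comp continuous_snd).neg
        (continuous_const.mul continuous_snd.norm)
    exact (isClosed_eq hFc continuous_const).inter ((isClosed_eq hGc continuous_const).inter c3)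
  have hgood : ∀ t ∈ Set.Icc (0:ℝ) 1, t ∈ T1 → ∀ z : ℂ, aeval z (Q t) = 0 →
      z.re ≤ 0 ∧ z.im = 0 := by
    intro t ht h1 z hz
    rcases H t ht z hz with h | h
    · exact h
    · have := h1 z
      rw [hz, norm_zero] at this
      have hp : 0 < |z.im| ^ r := pow_pos (abs_pos.2 h.1) r
      linarith
  have hgood' : ∀ t, (∀ z : ℂ, aeval z (Q t) = 0 → z.re ≤ 0 ∧ z.im = 0) → t ∈ T1 := by
    intro t h z
    have := tn_im_bound (Q t) (hQm t) (fun w hw => (h w hw).2) z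
    rwa [hQd] at this
  have hcover : Set.Icc (0:ℝ) 1 ⊆ T1 ∪ T2 := by
    intro t ht
    by_cases h : ∀ z : ℂ, aeval z (Q t) = 0 → z.re ≤ 0 ∧ z.im = 0
    · exact Or.inl (hgood' t h)
    · right
      push Not at h
      obtain ⟨z, hz, hz2⟩ := h
      rcases H t ht z hz with h | h
      · exact absurd h.2 (hz2 h.1)
      · refine ⟨(t, z), ⟨⟨ht, ?_⟩, hz, hGmul t z hz h.1, h.2⟩, rfl⟩
        simpa using hR t ht z hz
  have hQ00 : Q 0 = Q0 := by simp [Q]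
  have hQ11 : Q 1 = Q1 := by simp [Q]
  have h0T : (0:ℝ) ∈ T1 := hgood' 0 (by rw [hQ00]; exact H0)
  have h0I : (0:ℝ) ∈ Set.Icc (0:ℝ) 1 := by simp
  have h1I : (1:ℝ) ∈ Set.Icc (0:ℝ) 1 := by simp
  have hdisj : ¬ (Set.Icc (0:ℝ) 1 ∩ (T1 ∩ T2)).Nonempty := by
    rintro ⟨t, htI, ht1, ⟨⟨t', z⟩, ⟨-, hz, hG, hK⟩, rfl⟩⟩
    simp only at htI ht1 hz hG hK
    obtain ⟨g1, g2⟩ := hgood t' htI ht1 z hz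
    have hzr : z = (z.re : ℂ) := Complex.ext (by simp) (by simp [g2])
    have hnorm : ‖z‖ = -z.re := by
      rw [hzr, Complex.norm_real, Real.norm_eq_abs, abs_of_nonpos g1]; simp
    have hre : z.re = 0 := by
      rw [hnorm] at hK
      nlinarith
    have hz0 : z = 0 := by rw [hzr, hre]; simp
    subst hz0
    have hc0 : (Q t').coeff 0 = 0 := by
      rw [← coeff_zero_eq_aeval_zero'] at hz
      simpa using hz
    rcases htI.1.eq_or_lt with h | h
    · subst h
      rw [hQ00] at hc0
      rcases h01 with h | h
      · exact h hc0
      · simp only [G, tnDD_zero] at hG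
        apply h
        simpa using hG
    · rw [hQc] at hc0
      exact ht t' ⟨h, htI.2⟩ hc0
  have h1T : (1:ℝ) ∈ T1 := by
    by_contra h
    have h2 : (1:ℝ) ∈ T2 := (hcover h1I).resolve_left h
    exact hdisj (isPreconnected_closed_iff.1 isPreconnected_Icc T1 T2 hT1 hT2 hcover
      ⟨0, h0I, h0T⟩ ⟨1, h1I, h2⟩)
  exact hgood 1 h1I h1T w (by rw [hQ11]; exact hw)

lemma tn_coeff_ne_zero {n : ℕ} {A : Matrix (Fin n) (Fin n) ℝ} (hA : TotallyNonneg A) {j : ℕ}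
    (S : Finset (Fin n)) (hS : S.card + j = n) (h : tnpm A S ≠ 0) :
    (-A).charpoly.coeff j ≠ 0 := by
  have := tn_coeff A S.card (by omega)
  rw [show n - S.card = j by omega] at this
  rw [this]
  refine ne_of_gt (Finset.sum_pos' (fun S _ => hA.pm_nonneg S) ⟨S, ?_, ?_⟩)
  · simp
  · exact lt_of_le_of_ne (hA.pm_nonneg S) (Ne.symm h)

lemma tn_erase {n : ℕ} {B : Matrix (Fin n) (Fin n) ℝ} (hB : TotallyNonneg B) (p : Fin n)
    (S : Finset (Fin n)) (hp : p ∈ S) (hmax : ∀ j ∈ S, j ≤ p) (h : tnpm B S ≠ 0) :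
    tnpm B (S.erase p) ≠ 0 := by
  obtain ⟨k, hk⟩ : ∃ k, S.card = k + 1 :=
    Nat.exists_eq_succ_of_ne_zero (Finset.card_ne_zero_of_mem hp)
  have hk' : (S.erase p).card = k := by rw [Finset.card_erase_of_mem hp]; omega
  set e := S.orderEmbOfFin hk with he
  have hlast : e (Fin.last k) = p := by
    refine le_antisymm (hmax _ (S.orderEmbOfFin_mem hk _)) ?_
    have : p ∈ Set.range e := by rw [he, Finset.range_orderEmbOfFin]; exact hp
    obtain ⟨i, hi⟩ := this
    rw [← hi]
    exact e.monotone (Fin.le_last i)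
  have hu : (e ∘ Fin.castSucc) = (S.erase p).orderEmbOfFin hk' := by
    refine Finset.orderEmbOfFin_unique hk' (fun i => ?_)
      (e.strictMono.comp Fin.strictMono_castSucc)
    refine Finset.mem_erase.2 ⟨?_, S.orderEmbOfFin_mem hk _⟩
    rw [← hlast]
    exact (e.strictMono (Fin.castSucc_lt_last i)).ne
  rw [tnpm_eq B S hk] at h
  rw [tnpm_eq B _ hk', ← hu]
  refine tn_leading (B.submatrix e e) (fun m r c hr hc => ?_) h
  exact hB m (e ∘ r) (e ∘ c) (e.strictMono.comp hr) (e.strictMono.comp hc)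

lemma tn_prod {n : ℕ} (p : Fin n) (t : ℝ) (S : Finset (Fin n)) :
    ∏ i ∈ S, (if i = p then t else 1) = if p ∈ S then t else 1 := by
  rw [Finset.prod_ite_eq']

open Polynomial in
lemma tn_step {n : ℕ} {B : Matrix (Fin n) (Fin n) ℝ} (hB : TotallyNonneg B) (p : Fin n)
    (hz : ∀ i j, p < j → B i j = 0)
    (h0 : ∀ w : ℂ, aeval w
      (-(B * Matrix.diagonal (fun i => if i = p then (0:ℝ) else 1))).charpoly = 0 →
        (w.re ≤ 0 ∧ w.im = 0)) (w : ℂ) (hw : aeval w (-B).charpoly = 0) :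
    w.re ≤ 0 ∧ w.im = 0 := by
  let D : ℝ → Matrix (Fin n) (Fin n) ℝ := fun t =>
    B * Matrix.diagonal (fun i => if i = p then t else 1)
  let P : ℝ → ℝ[X] := fun t => (-(D t)).charpoly
  have hD : ∀ t, 0 ≤ t → TotallyNonneg (D t) := fun t ht =>
    hB.diagonal _ (fun i => by split_ifs <;> simp [ht])
  have hD1 : D 1 = B := by simp [D]
  have hpm : ∀ t S, tnpm (D t) S = tnpm B S * (if p ∈ S then t else 1) := by
    intro t S
    rw [tnpm_mul_diagonal, tn_prod]
  have hcoef : ∀ t j, (P t).coeff j = (1 - t) * (P 0).coeff j + t * (P 1).coeff j := by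
    intro t j
    by_cases hj : j ≤ n
    · have e : ∀ t, (P t).coeff j = ∑ S ∈ Finset.univ.powersetCard (n - j), tnpm (D t) S := by
        intro t
        rw [← tn_coeff _ _ (Nat.sub_le n j), Nat.sub_sub_self hj]
      rw [e, e, e, Finset.mul_sum, Finset.mul_sum, ← Finset.sum_add_distrib]
      refine Finset.sum_congr rfl fun S _ => ?_
      rw [hpm, hpm, hpm]
      split_ifs <;> ring
    · have e : ∀ t, (P t).coeff j = 0 := by
        intro t
        rw [coeff_eq_zero_of_natDegree_lt]
        rw [tn_natDegree]; omega
      rw [e, e, e]; ring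
  have hP : ∀ t, P t = C (1 - t) * P 0 + C t * P 1 := by
    intro t
    ext j
    rw [hcoef, coeff_add, coeff_C_mul, coeff_C_mul]
  have hm : ∀ t, (P t).Monic := fun t => Matrix.charpoly_monic _
  have hd : ∀ t, (P t).natDegree = n := fun t => tn_natDegree _
  have hnn : ∀ t, 0 ≤ t → ∀ j, 0 ≤ (P t).coeff j := fun t ht => (hD t ht).coeff_nonneg
  set l := (P 1).natTrailingDegree with hl
  have hl1 : (P 1).coeff l ≠ 0 := by
    have := trailingCoeff_nonzero_iff_nonzero.2 (hm 1).ne_zero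
    exact this
  have hln : l ≤ n := by rw [← hd 1]; exact natTrailingDegree_le_natDegree _
  have hlow1 : ∀ j < l, (P 1).coeff j = 0 := fun j hj => coeff_eq_zero_of_lt_natTrailingDegree hj
  have hlow0 : ∀ j < l, (P 0).coeff j = 0 := by
    intro j hj
    have a := hcoef 2 j
    have b := hnn 2 (by norm_num) j
    have c := hnn 0 le_rfl j
    rw [hlow1 j hj] at a
    linarith
  obtain ⟨Q0, hQ0⟩ := X_pow_dvd_iff.2 hlow0
  obtain ⟨Q1, hQ1⟩ := X_pow_dvd_iff.2 hlow1
  have m0 : Q0.Monic := (monic_X_pow l).of_mul_monic_left (hQ0 ▸ hm 0)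
  have m1 : Q1.Monic := (monic_X_pow l).of_mul_monic_left (hQ1 ▸ hm 1)
  have hdeg : ∀ t Q, Q.Monic → P t = X ^ l * Q → Q.natDegree = n - l := by
    intro t Q hQ h
    have := hd t
    rw [h, (monic_X_pow l).natDegree_mul hQ, natDegree_X_pow] at this
    omega
  have hc0 : ∀ i, Q0.coeff i = (P 0).coeff (i + l) := by
    intro i; rw [hQ0, coeff_X_pow_mul]
  have hc1 : ∀ i, Q1.coeff i = (P 1).coeff (i + l) := by
    intro i; rw [hQ1, coeff_X_pow_mul]
  have hgood : ∀ w : ℂ, aeval w Q1 = 0 → w.re ≤ 0 ∧ w.im = 0 := by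
    refine tn_path Q0 Q1 m0 m1 (hdeg 0 Q0 m0 hQ0) (hdeg 1 Q1 m1 hQ1)
      (Real.cos (Real.pi / (n + 1))) ?_ ?_ ?_ ?_ ?_
    · have hpi := Real.pi_pos
      refine lt_of_lt_of_eq (Real.cos_lt_cos_of_nonneg_of_le_pi le_rfl ?_ (by positivity))
        Real.cos_zero
      exact div_le_self hpi.le (by linarith [(Nat.cast_nonneg n : (0:ℝ) ≤ n)])
    · intro t ht z hz
      refine tn_gap (hD t ht.1) z ?_
      change aeval z (P t) = 0
      have : P t = X ^ l * (C (1 - t) * Q0 + C t * Q1) := by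
        rw [hP, hQ0, hQ1]; ring
      rw [this, map_mul, hz, mul_zero]
    · intro z hz
      refine h0 z ?_
      change aeval z (P 0) = 0
      rw [hQ0, map_mul, hz, mul_zero]
    · rw [hc0, hc0, zero_add]
      have e : (P 1).coeff l = ∑ S ∈ Finset.univ.powersetCard (n - l), tnpm (D 1) S := by
        rw [← tn_coeff _ _ (Nat.sub_le n l), Nat.sub_sub_self hln]
      rw [e] at hl1
      obtain ⟨S, hS, hS0⟩ := Finset.exists_ne_zero_of_sum_ne_zero hl1
      have hcard := (Finset.mem_powersetCard.1 hS).2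
      rw [hD1] at hS0
      by_cases hpS : p ∈ S
      · right
        have hmax : ∀ j ∈ S, j ≤ p := by
          intro j hj
          by_contra! hlt
          exact hS0 (Matrix.det_eq_zero_of_column_eq_zero ⟨j, hj⟩ fun i => hz _ _ hlt)
        have h1 := tn_erase hB p S hpS hmax hS0
        refine tn_coeff_ne_zero (hD 0 le_rfl) (S.erase p) ?_ ?_
        · have := Finset.card_pos.2 ⟨p, hpS⟩
          rw [Finset.card_erase_of_mem hpS]
          omega
        · rw [hpm]
          simpa using h1
      · left
        refine tn_coeff_ne_zero (hD 0 le_rfl) S (by omega) ?_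
        rw [hpm]
        simpa [hpS] using hS0
    · intro t ht
      rw [hc0, hc1, zero_add]
      have a := hnn 0 le_rfl l
      have b := lt_of_le_of_ne (hnn 1 zero_le_one l) (Ne.symm hl1)
      have c := mul_nonneg (show 0 ≤ 1 - t by linarith [ht.2]) a
      have d := mul_pos ht.1 b
      linarith
  have hw1 : aeval w (P 1) = 0 := by
    change aeval w (-(D 1)).charpoly = 0
    rw [hD1, hw]
  rw [hQ1, map_mul] at hw1
  rcases mul_eq_zero.1 hw1 with h | h
  · rw [map_pow, aeval_X] at h
    have := eq_zero_of_pow_eq_zero h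
    simp [this]
  · exact hgood w h

open Polynomial in
lemma tn_all {n : ℕ} {A : Matrix (Fin n) (Fin n) ℝ} (hA : TotallyNonneg A) (k : ℕ) (hk : k ≤ n) :
    ∀ w : ℂ, aeval w
      (-(A * Matrix.diagonal (fun i : Fin n => if (i : ℕ) < k then (1:ℝ) else 0))).charpoly = 0 →
        (w.re ≤ 0 ∧ w.im = 0) := by
  induction k with
  | zero =>
    intro w hw
    have e : (Matrix.diagonal (fun i : Fin n => if (i : ℕ) < 0 then (1:ℝ) else 0)) = 0 := by
      simp
    rw [e, mul_zero, neg_zero, Matrix.charpoly_zero, map_pow, aeval_X] at hw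
    have := eq_zero_of_pow_eq_zero hw
    simp [this]
  | succ k ih =>
    refine tn_step (hA.diagonal _ fun i => by split_ifs <;> simp) ⟨k, hk⟩ ?_ ?_
    · intro i j hj
      have : ¬ (j : ℕ) < k + 1 := by
        have : k < (j : ℕ) := hj
        omega
      rw [Matrix.mul_diagonal, if_neg this, mul_zero]
    · have e : A * Matrix.diagonal (fun i : Fin n => if (i : ℕ) < k + 1 then (1:ℝ) else 0) *
          Matrix.diagonal (fun i => if i = ⟨k, hk⟩ then (0:ℝ) else 1) =
          A * Matrix.diagonal (fun i : Fin n => if (i : ℕ) < k then (1:ℝ) else 0) := by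
        rw [mul_assoc, Matrix.diagonal_mul_diagonal]
        congr 2
        ext i
        have : i = ⟨k, hk⟩ ↔ (i : ℕ) = k := by rw [Fin.ext_iff]
        simp only [this]
        split_ifs <;> first | omega | simp
      rw [e]
      exact ih (by omega)

/-- Every eigenvalue over `ℂ` (i.e. every root of the characteristic polynomial of the
complexified matrix) of a totally nonnegative real matrix is a nonnegative real
number. -/
theorem eigenvalues_of_totallyNonneg_nonneg {n : ℕ} (A : Matrix (Fin n) (Fin n) ℝ)
    (hA : TotallyNonneg A) (μ : ℂ)
    (hμ : (Matrix.charpoly (A.map (algebraMap ℝ ℂ))).IsRoot μ) :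
    ∃ r : ℝ, 0 ≤ r ∧ μ = (r : ℂ) := by
  have h1 : μ ∈ spectrum ℂ (A.map (algebraMap ℝ ℂ)) :=
    Matrix.mem_spectrum_iff_isRoot_charpoly.2 hμ
  rw [← neg_neg μ, ← tn_root_iff] at h1
  have h2 := tn_all hA n le_rfl (-μ)
  have e : (Matrix.diagonal (fun i : Fin n => if (i : ℕ) < n then (1:ℝ) else 0)) = 1 := by
    simp
  rw [e, mul_one] at h2
  obtain ⟨h3, h4⟩ := h2 h1
  refine ⟨μ.re, by simpa using h3, ?_⟩
  exact Complex.ext (by simp) (by simpa using h4)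
end

section
/- Let n ≥ 1 and let H be an n×n real matrix that is a finite product of step matrices, where a step matrix is an n×n matrix equal to the identity except in one row k with 1 < k < n, in which the entries in columns k-1, k, k+1 are respectively c ≥ 0, d > 0, e ≥ 0 and all other entries of that row are zero. Then every eigenvalue of H over the complex numbers is a positive real number. -/
/-- A *step matrix* of harmonic continuation: an `n × n` real matrix equal to the
identity except in one interior row `k` (zero-based: `0 < k` and `k + 1 < n`), in
which the entries in columns `k-1`, `k`, `k+1` are respectively `c ≥ 0`, `d > 0`,
`e ≥ 0` and all other entries of that row are zero. -/
def IsStepMatrix {n : ℕ} (S : Matrix (Fin n) (Fin n) ℝ) : Prop :=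
  ∃ (k : Fin n) (_ : 0 < (k : ℕ)) (_ : (k : ℕ) + 1 < n) (c d e : ℝ),
    0 ≤ c ∧ 0 < d ∧ 0 ≤ e ∧
    ∀ i j : Fin n, S i j =
      if i = k then
        (if (j : ℕ) + 1 = (k : ℕ) then c
         else if j = k then d
         else if (j : ℕ) = (k : ℕ) + 1 then e
         else 0)
      else (if i = j then 1 else 0)

/-- `v` has an alternating weakly increasing sequence of `m` entries, starting with a
positive one. -/
def AltSeq {n : ℕ} (m : ℕ) (v : Fin n → ℝ) : Prop :=
  ∃ f : ℕ → Fin n, (∀ j, j + 1 < m → f j ≤ f (j + 1)) ∧ ∀ j, j < m → 0 < (-1 : ℝ) ^ j * v (f j)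

/-- The first nonzero entry of `v` is positive. -/
def FirstPos {n : ℕ} (v : Fin n → ℝ) : Prop :=
  ∃ p : Fin n, 0 < v p ∧ ∀ i, i < p → v i = 0

lemma step_mulVec {n : ℕ} {S : Matrix (Fin n) (Fin n) ℝ} (hS : IsStepMatrix S) :
    ∃ (k k₁ k₂ : Fin n) (c d e : ℝ), (k₁ : ℕ) + 1 = k ∧ (k₂ : ℕ) = k + 1 ∧ 0 ≤ c ∧ 0 < d ∧ 0 ≤ e ∧
      ∀ v : Fin n → ℝ, (∀ i, i ≠ k → (S.mulVec v) i = v i) ∧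
        (S.mulVec v) k = c * v k₁ + d * v k + e * v k₂ := by
  obtain ⟨k, hk, hk', c, d, e, hc, hd, he, h⟩ := hS
  refine ⟨k, ⟨k - 1, by omega⟩, ⟨k + 1, hk'⟩, c, d, e, by simp; omega, rfl, hc, hd, he, ?_⟩
  intro v
  refine ⟨?_, ?_⟩
  · intro i hi
    simp [Matrix.mulVec, dotProduct, h, hi]
  · have : ∀ j : Fin n, S k j * v j = (if j = (⟨k - 1, by omega⟩ : Fin n) then c * v j else 0)
        + (if j = k then d * v j else 0) + (if j = (⟨k + 1, hk'⟩ : Fin n) then e * v j else 0) := by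
      intro j
      rw [h]
      simp only [if_true, Fin.ext_iff]
      split_ifs <;> first | omega | simp
    simp only [Matrix.mulVec, dotProduct, this, Finset.sum_add_distrib]
    simp

lemma step_alt {n : ℕ} {S : Matrix (Fin n) (Fin n) ℝ} (hS : IsStepMatrix S) (m : ℕ)
    (v : Fin n → ℝ) (h : AltSeq m (S.mulVec v)) : AltSeq m v := by
  obtain ⟨k, k₁, k₂, c, d, e, h₁, h₂, hc, hd, he, hv⟩ := step_mulVec hS
  obtain ⟨hne, hk⟩ := hv v
  obtain ⟨f, hf, hs⟩ := h
  have key : ∀ j, ∃ q : Fin n, j < m → 0 < (-1 : ℝ) ^ j * v q ∧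
      (f j ≠ k → q = f j) ∧ (f j = k → (k₁ ≤ q ∧ q ≤ k₂)) := by
    intro j
    by_cases hj : j < m
    swap
    · exact ⟨k, fun h => absurd h hj⟩
    have hsj := hs j hj
    by_cases hfk : f j = k
    · rw [hfk, hk] at hsj
      have : 0 < (-1 : ℝ) ^ j * v k₁ ∨ 0 < (-1 : ℝ) ^ j * v k ∨ 0 < (-1 : ℝ) ^ j * v k₂ := by
        by_contra! hcon
        obtain ⟨x, y, z⟩ := hcon
        have := mul_nonneg hc (neg_nonneg.2 x)
        have := mul_nonneg hd.le (neg_nonneg.2 y)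
        have := mul_nonneg he (neg_nonneg.2 z)
        nlinarith
      rcases this with h | h | h
      · exact ⟨k₁, fun _ => ⟨h, fun h => absurd hfk h, fun _ => by
          simp only [Fin.le_def]; omega⟩⟩
      · exact ⟨k, fun _ => ⟨h, fun h => absurd hfk h, fun _ => by
          simp only [Fin.le_def]; omega⟩⟩
      · exact ⟨k₂, fun _ => ⟨h, fun h => absurd hfk h, fun _ => by
          simp only [Fin.le_def]; omega⟩⟩
    · rw [hne _ hfk] at hsj
      exact ⟨f j, fun _ => ⟨hsj, fun _ => rfl, fun h => absurd h hfk⟩⟩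
  choose g hg using key
  refine ⟨g, ?_, fun j hj => (hg j hj).1⟩
  intro j hj
  obtain ⟨-, a1, a2⟩ := hg j (by omega)
  obtain ⟨-, b1, b2⟩ := hg (j + 1) hj
  have hle := hf j hj
  by_cases hA : f j = k <;> by_cases hB : f (j + 1) = k
  · exfalso
    have x := hs j (by omega)
    have y := hs (j + 1) hj
    rw [hA] at x
    rw [hB, pow_succ] at y
    linarith
  · have := b1 hB
    have := a2 hA
    simp only [Fin.le_def, Fin.ext_iff] at *
    omega
  · have := a1 hA
    have := b2 hB
    simp only [Fin.le_def, Fin.ext_iff] at *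
    omega
  · rw [a1 hA, b1 hB]; exact hle

lemma prod_alt {n : ℕ} (L : List (Matrix (Fin n) (Fin n) ℝ)) (hL : ∀ S ∈ L, IsStepMatrix S)
    (m : ℕ) (v : Fin n → ℝ) (h : AltSeq m (L.prod.mulVec v)) : AltSeq m v := by
  induction L with
  | nil => simpa using h
  | cons S L ih =>
    rw [List.prod_cons, ← Matrix.mulVec_mulVec] at h
    exact ih (fun S hS => hL S (by simp [hS])) (step_alt (hL S (by simp)) m _ h)

lemma prod_inj {n : ℕ} (L : List (Matrix (Fin n) (Fin n) ℝ)) (hL : ∀ S ∈ L, IsStepMatrix S)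
    (v : Fin n → ℝ) (h : L.prod.mulVec v = 0) : v = 0 := by
  induction L with
  | nil => simpa using h
  | cons S L ih =>
    rw [List.prod_cons, ← Matrix.mulVec_mulVec] at h
    apply ih (fun S hS => hL S (by simp [hS]))
    obtain ⟨k, k₁, k₂, c, d, e, h₁, h₂, hc, hd, he, hv⟩ := step_mulVec (hL S (by simp))
    generalize L.prod.mulVec v = w at *
    obtain ⟨hne, hk⟩ := hv w
    rw [h] at hne hk
    have hz : ∀ i, i ≠ k → w i = 0 := fun i hi => (hne i hi).symm
    rw [hz k₁ (by simp only [ne_eq, Fin.ext_iff]; omega),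
      hz k₂ (by simp only [ne_eq, Fin.ext_iff]; omega)] at hk
    have hk0 : w k = 0 := by
      have : d * w k = 0 := by simpa using hk.symm
      exact (mul_eq_zero.1 this).resolve_left hd.ne'
    funext i
    by_cases hi : i = k
    · rw [hi, hk0]; rfl
    · exact hz i hi

lemma alt_le {n : ℕ} (m : ℕ) (v : Fin n → ℝ) (h : AltSeq m v) : m ≤ n := by
  obtain ⟨f, hf, hs⟩ := h
  have : ∀ j, j < m → j ≤ (f j : ℕ) := by
    intro j
    induction j with
    | zero => simp
    | succ j ih =>
      intro hj
      have h1 := ih (by omega)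
      have h2 := hf j hj
      have h3 : f j ≠ f (j + 1) := by
        intro h
        have x := hs j (by omega)
        have y := hs (j + 1) hj
        rw [← h, pow_succ] at y
        linarith
      simp only [Fin.le_def, ne_eq, Fin.ext_iff] at *
      omega
  by_contra hcon
  have := this n (by omega)
  have := (f n).2
  omega

lemma alt_succ {n : ℕ} (m : ℕ) (v : Fin n → ℝ) (hv : FirstPos v) (h : AltSeq m (-v)) :
    AltSeq (m + 1) v := by
  obtain ⟨p, hp, hlt⟩ := hv
  obtain ⟨f, hf, hs⟩ := h
  refine ⟨fun j => Nat.casesOn j p f, ?_, ?_⟩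
  · intro j hj
    cases j with
    | zero =>
      by_contra hcon
      have := hs 0 (by omega)
      have h2 := hlt (f 0) (not_le.1 hcon)
      simp [h2] at this
    | succ j => exact hf j (by omega)
  · intro j hj
    cases j with
    | zero => simpa using hp
    | succ j =>
      have := hs j (by omega)
      simp only [Pi.neg_apply] at this
      simp only [pow_succ]
      linarith

open Classical in
/-- Length of the longest alternating sequence starting with a positive entry. -/
noncomputable def altNum {n : ℕ} (v : Fin n → ℝ) : ℕ := Nat.findGreatest (fun m => AltSeq m v) n

lemma altNum_lt {n : ℕ} (hn : 1 ≤ n) (v : Fin n → ℝ) (hv : FirstPos v) :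
    altNum (-v) < altNum v := by
  classical
  have h0 : AltSeq 0 (-v) := ⟨fun _ => ⟨0, hn⟩, by simp, by simp⟩
  have h : AltSeq (altNum (-v)) (-v) := by
    unfold altNum
    convert Nat.findGreatest_spec (P := fun m => AltSeq m (-v)) (Nat.zero_le n) h0
  have h' := alt_succ _ _ hv h
  have := Nat.le_findGreatest (P := fun m => AltSeq m v) (alt_le _ _ h') h'
  unfold altNum at *
  exact Nat.lt_of_succ_le this

lemma altNum_mono {n : ℕ} (v w : Fin n → ℝ) (h : ∀ m, AltSeq m v → AltSeq m w) :
    altNum v ≤ altNum w := by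
  classical
  unfold altNum
  exact Nat.findGreatest_mono_left h n

lemma firstPos_or {n : ℕ} (v : Fin n → ℝ) (hv : v ≠ 0) : FirstPos v ∨ FirstPos (-v) := by
  obtain ⟨i, hi⟩ := Function.ne_iff.1 hv
  obtain ⟨p, hp, hmin⟩ := WellFounded.has_min (wellFounded_lt (α := Fin n)) {i | v i ≠ 0} ⟨i, hi⟩
  have hz : ∀ i, i < p → v i = 0 := fun i hi => by
    by_contra h
    exact hmin i h hi
  rcases lt_or_gt_of_ne hp with h | h
  · right
    exact ⟨p, by simpa using h, fun i hi => by simp [hz i hi]⟩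
  · left
    exact ⟨p, h, hz⟩

lemma firstPos_nonneg {n : ℕ} (v : Fin n → ℝ) (hv : FirstPos v) (p : Fin n)
    (hp : ∀ i, i < p → v i = 0) : 0 ≤ v p := by
  obtain ⟨q, hq, hlt⟩ := hv
  rcases lt_trichotomy p q with h | h | h
  · exact (hlt p h).ge
  · rw [h]; exact hq.le
  · rw [hp q h] at hq; exact absurd hq (lt_irrefl _)

lemma eventually_const (a : ℕ → ℕ) (h : ∀ t, a (t + 1) ≤ a t) : ∃ T, ∀ t, T ≤ t → a t = a T := by
  have ha : Antitone a := antitone_nat_of_succ_le h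
  obtain ⟨T, hT⟩ := WellFounded.has_min (wellFounded_lt (α := ℕ)) (Set.range a) ⟨a 0, 0, rfl⟩
  obtain ⟨⟨T, rfl⟩, hmin⟩ := hT
  exact ⟨T, fun t ht => le_antisymm (ha ht) (not_lt.1 (hmin _ ⟨t, rfl⟩))⟩

lemma no_neg (μ : ℂ) (hμ : μ ≠ 0) (T : ℕ) (h : ∀ t, T ≤ t → (μ ^ t).re ≤ 0) : False := by
  have key : ∀ z : ℂ, z ≠ 0 → z.re ≤ 0 → (z ^ 2).re ≤ 0 → (z ^ 3).re ≤ 0 → (z ^ 4).re ≤ 0 →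
      False := by
    intro z hz h1 h2 h3 h4
    obtain ⟨x, y⟩ := z
    simp only [pow_succ, pow_zero, one_mul, Complex.mul_re, Complex.mul_im] at h1 h2 h3 h4
    have hx : x = 0 := by
      by_contra hx
      have hx' : x < 0 := lt_of_le_of_ne h1 hx
      have : 0 < x ^ 2 := by positivity
      nlinarith
    subst hx
    have hy : y ≠ 0 := fun hy => hz (by subst hy; rfl)
    have : 0 < y ^ 4 := by positivity
    nlinarith
  apply key (μ ^ T) (pow_ne_zero _ hμ) (h T le_rfl) <;> rw [← pow_mul] <;> exact h _ (by omega)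

lemma unit_one (u : ℂ) (hu : ‖u‖ = 1) (h : ∀ k : ℕ, 0 ≤ (u ^ (2 ^ k)).re) : u = 1 := by
  have hk : ∀ k : ℕ, 2 ^ k * (1 - u.re) ≤ 1 - (u ^ (2 ^ k)).re := by
    intro k
    induction k with
    | zero => simp
    | succ k ih =>
      have h0 := h k
      have hn : ‖u ^ (2 ^ k)‖ = 1 := by rw [norm_pow, hu, one_pow]
      rw [show u ^ (2 ^ (k + 1)) = (u ^ (2 ^ k)) ^ 2 by rw [← pow_mul, ← pow_succ]]
      have hsq : (u ^ (2 ^ k)).re ^ 2 + (u ^ (2 ^ k)).im ^ 2 = 1 := by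
        have := Complex.sq_norm (u ^ (2 ^ k))
        rw [hn, Complex.normSq_apply] at this
        nlinarith
      have hle : (u ^ (2 ^ k)).re ≤ 1 := hn ▸ Complex.re_le_norm _
      generalize u ^ (2 ^ k) = z at *
      have : (z ^ 2).re = z.re ^ 2 - z.im ^ 2 := by
        rw [pow_two, Complex.mul_re]; ring
      rw [this, pow_succ]
      nlinarith
  have hre : u.re = 1 := by
    have hle : u.re ≤ 1 := hu ▸ Complex.re_le_norm u
    by_contra hne
    have hlt : 0 < 1 - u.re := by
      have := lt_of_le_of_ne hle hne
      linarith
    obtain ⟨k, hk'⟩ := pow_unbounded_of_one_lt (1 / (1 - u.re)) (one_lt_two (α := ℝ))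
    rw [div_lt_iff₀ hlt] at hk'
    have := hk k
    have := h k
    linarith
  have := Complex.sq_norm u
  rw [hu, Complex.normSq_apply, hre] at this
  apply Complex.ext
  · simpa using hre
  · have : u.im * u.im = 0 := by linarith
    simpa using this

lemma pos_of_pow_re (μ : ℂ) (hμ : μ ≠ 0) (T : ℕ) (h : ∀ t, T ≤ t → 0 ≤ (μ ^ t).re) :
    μ = (‖μ‖ : ℂ) := by
  have hn : 0 < ‖μ‖ := norm_pos_iff.2 hμ
  have hnc : (‖μ‖ : ℂ) ≠ 0 := by exact_mod_cast hn.ne'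
  obtain ⟨u, hu⟩ : ∃ u : ℂ, u = μ / (‖μ‖ : ℂ) := ⟨_, rfl⟩
  have hu1 : ‖u‖ = 1 := by
    rw [hu, norm_div, Complex.norm_real, norm_norm, div_self hn.ne']
  have hre : ∀ t, T ≤ t → 0 ≤ (u ^ t).re := by
    intro t ht
    rw [hu, div_pow, ← Complex.ofReal_pow, Complex.div_ofReal_re]
    exact div_nonneg (h t ht) (by positivity)
  have hone : ∀ t, T ≤ t → u ^ t = 1 := by
    intro t ht
    apply unit_one _ (by rw [norm_pow, hu1, one_pow])
    intro k
    rw [← pow_mul]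
    exact hre _ (ht.trans (Nat.le_mul_of_pos_right _ (by positivity)))
  have h1 := hone (T + 1) (by omega)
  rw [pow_succ, hone T le_rfl, one_mul, hu, div_eq_one_iff_eq hnc] at h1
  exact h1

/-- If `H` is a finite product of step matrices, then every eigenvalue of `H` over the
complex numbers (i.e. every root of the characteristic polynomial of the complexified
matrix) is a positive real number. -/
theorem eigenvalues_of_product_of_step_matrices_pos {n : ℕ} (hn : 1 ≤ n)
    (H : Matrix (Fin n) (Fin n) ℝ)
    (L : List (Matrix (Fin n) (Fin n) ℝ))
    (hL : ∀ S ∈ L, IsStepMatrix S) (hH : H = L.prod)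
    (μ : ℂ) (hμ : (Matrix.charpoly (H.map (algebraMap ℝ ℂ))).IsRoot μ) :
    ∃ r : ℝ, 0 < r ∧ μ = (r : ℂ) := by
  obtain ⟨z, hz0, hz⟩ : ∃ z : Fin n → ℂ, z ≠ 0 ∧ (H.map (algebraMap ℝ ℂ)).mulVec z = μ • z := by
    rw [Polynomial.IsRoot, Matrix.eval_charpoly] at hμ
    obtain ⟨z, hz0, hz⟩ := Matrix.exists_mulVec_eq_zero_iff.2 hμ
    refine ⟨z, hz0, ?_⟩
    rw [Matrix.sub_mulVec, sub_eq_zero] at hz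
    rw [← hz]
    ext i
    simp [Matrix.scalar_apply, Matrix.mulVec_diagonal]
  obtain ⟨i, hi⟩ := Function.ne_iff.1 hz0
  obtain ⟨p, hp, hmin⟩ := WellFounded.has_min (wellFounded_lt (α := Fin n)) {i | z i ≠ 0} ⟨i, hi⟩
  have hzp : ∀ i, i < p → z i = 0 := fun i hi => by
    by_contra h
    exact hmin i h hi
  have hp : z p ≠ 0 := hp
  obtain ⟨v, hv⟩ : ∃ v : ℕ → Fin n → ℝ, v = fun t i => (μ ^ t * (z i / z p)).re := ⟨_, rfl⟩
  have hvs : ∀ t, H.mulVec (v t) = v (t + 1) := by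
    intro t
    ext i
    have := congrFun hz i
    simp only [Matrix.mulVec, dotProduct, Matrix.map_apply, Pi.smul_apply, smul_eq_mul] at this
    have h2 : ∑ j, (algebraMap ℝ ℂ) (H i j) * (μ ^ t * (z j / z p)) = μ ^ (t + 1) * (z i / z p) := by
      rw [pow_succ, mul_assoc, ← mul_div_assoc, ← this, Finset.sum_div, Finset.mul_sum]
      refine Finset.sum_congr rfl fun j _ => ?_
      ring
    rw [hv]
    simp only [Matrix.mulVec, dotProduct]
    rw [← h2, Complex.re_sum]
    refine Finset.sum_congr rfl fun j _ => ?_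
    simp
  have hvp : ∀ t, v t p = (μ ^ t).re := by
    intro t
    simp [hv, div_self hp]
  have hvlt : ∀ t i, i < p → v t i = 0 := by
    intro t i hi
    simp [hv, hzp i hi]
  have hv0 : ∀ t, v t ≠ 0 := by
    intro t
    induction t with
    | zero =>
      intro h
      have := hvp 0
      rw [h] at this
      simp at this
    | succ t ih =>
      intro h
      rw [← hvs, hH] at h
      exact ih (prod_inj L hL _ h)
  have hμ0 : μ ≠ 0 := by
    intro h
    apply hv0 1
    simp [hv, h]
    rfl
  obtain ⟨T₁, hT₁⟩ := eventually_const (fun t => altNum (v t)) (fun t => altNum_mono _ _ (by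
    intro m hm
    rw [← hvs, hH] at hm
    exact prod_alt L hL m _ hm))
  obtain ⟨T₂, hT₂⟩ := eventually_const (fun t => altNum (-v t)) (fun t => altNum_mono _ _ (by
    intro m hm
    rw [← hvs, hH, ← Matrix.mulVec_neg] at hm
    exact prod_alt L hL m _ hm))
  have ha : ∀ t, max T₁ T₂ ≤ t → altNum (v t) = altNum (v T₁) := fun t ht =>
    hT₁ t (le_trans (le_max_left _ _) ht)
  have hb : ∀ t, max T₁ T₂ ≤ t → altNum (-v t) = altNum (-v T₂) := fun t ht =>
    hT₂ t (le_trans (le_max_right _ _) ht)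
  rcases lt_or_ge (altNum (-v T₂)) (altNum (v T₁)) with hlt | hge
  · refine ⟨‖μ‖, norm_pos_iff.2 hμ0, pos_of_pow_re μ hμ0 (max T₁ T₂) ?_⟩
    intro t ht
    rw [← hvp]
    rcases firstPos_or _ (hv0 t) with h | h
    · exact firstPos_nonneg _ h p (hvlt t)
    · have := altNum_lt hn _ h
      rw [neg_neg, ha t ht, hb t ht] at this
      omega
  · exfalso
    apply no_neg μ hμ0 (max T₁ T₂)
    intro t ht
    rw [← hvp]
    rcases firstPos_or _ (hv0 t) with h | h
    · have := altNum_lt hn _ h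
      rw [ha t ht, hb t ht] at this
      omega
    · have := firstPos_nonneg _ h p (fun i hi => by simp [hvlt t i hi])
      simpa using this
end
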